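/- Assume every nonzero weight matrix W(i,j) is positive definite and the network has a spanning tree. Then for μ-almost every sequence ω : ℕ → V, the products 𝓟(t)·𝓟(t−1)···𝓟(0) converge entrywise as t → ∞ to a block-diagonal matrix whose i-th diagonal block (for each i ∈ {1,…,d}) is an n×n matrix all of whose rows are equal (hence each diagonal block has rank one). -/

import Mathlib

open Matrix MeasureTheory Filter
open scoped Classical

noncomputable section

/-- Matrix sign: 1 for positive definite, -1 for negative definite, 0 otherwise. -/
def msgn {d : ℕ} (S : Matrix (Fin d) (Fin d) ℝ) : ℝ :=
  if S.PosDef then 1 else if (-S).PosDef then -1 else 0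

/-- In-neighborhood of agent `i`: agents `j` with `W i j ≠ 0`. -/
def nbhd {n d : ℕ} (W : Fin n → Fin n → Matrix (Fin d) (Fin d) ℝ) (i : Fin n) :
    Finset (Fin n) :=
  Finset.univ.filter (fun j => W i j ≠ 0)

/-- The network has a spanning tree: some agent `r` has a directed path
`r = v₀, v₁, …, v_m = i` with `W (v_{k+1}) (v_k) ≠ 0` to every agent `i`. -/
def hasSpanningTree {n d : ℕ} (W : Fin n → Fin n → Matrix (Fin d) (Fin d) ℝ) : Prop :=
  ∃ r : Fin n, ∀ i : Fin n, Relation.ReflTransGen (fun a b => W b a ≠ 0) r i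

/-- The step-size condition on `τ`. -/
def stepOK {n d : ℕ} (W : Fin n → Fin n → Matrix (Fin d) (Fin d) ℝ) (τ : ℝ) : Prop :=
  0 < τ ∧ ∀ (i : Fin n) (k m : Fin d),
    2 * τ * (∑ j ∈ nbhd W i, msgn (W i j) * (W i j) k m) < 1

/-- The matrices `P_i ∈ ℝ^{n×n}`. -/
def Pmat {n d : ℕ} (W : Fin n → Fin n → Matrix (Fin d) (Fin d) ℝ) (τ : ℝ) (i : Fin d) :
    Matrix (Fin n) (Fin n) ℝ :=
  fun k m =>
    if k = m then 1 - τ * ∑ l ∈ nbhd W k, msgn (W k l) * (W k l) i i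
    else τ * (W k m) i i

/-- The matrices `Q_{ij} ∈ ℝ^{n×n}` (for `i ≠ j`). -/
def Qmat {n d : ℕ} (W : Fin n → Fin n → Matrix (Fin d) (Fin d) ℝ) (τ : ℝ) (i j : Fin d) :
    Matrix (Fin n) (Fin n) ℝ :=
  fun k m =>
    if k = m then -(τ * ∑ l ∈ nbhd W k, msgn (W k l) * (W k l) i j)
    else τ * (W k m) i j

/-- The block-diagonal matrix `𝓟 ∈ ℝ^{nd×nd}` with diagonal blocks `P_1,…,P_d`. -/
def bigP {n d : ℕ} (W : Fin n → Fin n → Matrix (Fin d) (Fin d) ℝ) (τ : ℝ) :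
    Matrix (Fin d × Fin n) (Fin d × Fin n) ℝ :=
  fun p q => if p.1 = q.1 then Pmat W τ p.1 p.2 q.2 else 0

/-- The block matrix `𝓠 ∈ ℝ^{nd×nd}` with zero diagonal blocks and off-diagonal
blocks `Q_{ij}`. -/
def bigQ {n d : ℕ} (W : Fin n → Fin n → Matrix (Fin d) (Fin d) ℝ) (τ : ℝ) :
    Matrix (Fin d × Fin n) (Fin d × Fin n) ℝ :=
  fun p q => if p.1 = q.1 then 0 else Qmat W τ p.1 q.1 p.2 q.2

/-- `𝓕 = 𝓟 + 𝓠`. -/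
def bigF {n d : ℕ} (W : Fin n → Fin n → Matrix (Fin d) (Fin d) ℝ) (τ : ℝ) :
    Matrix (Fin d × Fin n) (Fin d × Fin n) ℝ :=
  bigP W τ + bigQ W τ

/-- `𝓟(t)`: agrees with `𝓟` in the rows indexed by agent `ω t` inside each block,
and equals the identity in all other rows. -/
def Pt {n d : ℕ} (W : Fin n → Fin n → Matrix (Fin d) (Fin d) ℝ) (τ : ℝ)
    (ω : ℕ → Fin n) (t : ℕ) : Matrix (Fin d × Fin n) (Fin d × Fin n) ℝ :=
  fun p q => if p.2 = ω t then bigP W τ p q else (if p = q then 1 else 0)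

/-- `𝓠(t)`: agrees with `𝓠` in the rows indexed by agent `ω t` inside each block,
and is zero in all other rows. -/
def Qt {n d : ℕ} (W : Fin n → Fin n → Matrix (Fin d) (Fin d) ℝ) (τ : ℝ)
    (ω : ℕ → Fin n) (t : ℕ) : Matrix (Fin d × Fin n) (Fin d × Fin n) ℝ :=
  fun p q => if p.2 = ω t then bigQ W τ p q else 0

/-- `𝓕(t) = 𝓟(t) + 𝓠(t)`. -/
def Ft {n d : ℕ} (W : Fin n → Fin n → Matrix (Fin d) (Fin d) ℝ) (τ : ℝ)
    (ω : ℕ → Fin n) (t : ℕ) : Matrix (Fin d × Fin n) (Fin d × Fin n) ℝ :=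
  Pt W τ ω t + Qt W τ ω t

/-- The backward product `M t · M (t-1) ⋯ M 0`. -/
def backProd {ι : Type*} [Fintype ι] [DecidableEq ι]
    (M : ℕ → Matrix ι ι ℝ) : ℕ → Matrix ι ι ℝ
  | 0 => M 0
  | t + 1 => M (t + 1) * backProd M t

/-- `μ` is the countable product of uniform probability measures on `Fin n`,
characterized by its values on cylinder sets. -/
def isIIDUniform {n : ℕ} (μ : Measure (ℕ → Fin n)) : Prop :=
  IsProbabilityMeasure μ ∧
    ∀ (m : ℕ) (f : ℕ → Fin n),
      μ {ω | ∀ t < m, ω t = f t} = (1 / (n : ENNReal)) ^ m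

/-- The induced graph of a square real matrix (edge `a → b` iff `S a b > 0`)
has a spanning tree. -/
def inducedHasSpanningTree {ι : Type*} (S : Matrix ι ι ℝ) : Prop :=
  ∃ r : ι, ∀ b : ι, Relation.ReflTransGen (fun a c => S a c > 0) r b

end

/-- The product of the matrices `A a` along a word, the first letter acting first. -/
def wordProd {ι κ : Type*} [Fintype ι] [DecidableEq ι] (A : κ → Matrix ι ι ℝ) :
    List κ → Matrix ι ι ℝ
  | [] => 1
  | a :: l => wordProd A l * A a

theorem mul_apply_pos {ι : Type*} [Fintype ι] {A B : Matrix ι ι ℝ}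
    (hA : ∀ i j, 0 ≤ A i j) (hB : ∀ i j, 0 ≤ B i j)
    {i j k : ι} (hij : 0 < A i j) (hjk : 0 < B j k) : 0 < (A * B) i k := by
  rw [Matrix.mul_apply]
  exact Finset.sum_pos' (fun l _ => mul_nonneg (hA i l) (hB l k))
    ⟨j, Finset.mem_univ j, mul_pos hij hjk⟩

section Contraction

variable {ι κ : Type*} [Fintype ι] [DecidableEq ι]

theorem wordProd_append (A : κ → Matrix ι ι ℝ) (l l' : List κ) :
    wordProd A (l ++ l') = wordProd A l' * wordProd A l := by
  induction l with
  | nil => simp [wordProd]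
  | cons a l ih => simp [wordProd, ih, Matrix.mul_assoc]

theorem wordProd_mem_rowStochastic {A : κ → Matrix ι ι ℝ}
    (hA : ∀ a, A a ∈ rowStochastic ℝ ι) (l : List κ) :
    wordProd A l ∈ rowStochastic ℝ ι := by
  induction l with
  | nil => exact one_mem _
  | cons a l ih => exact mul_mem ih (hA a)

theorem wordProd_diag_pos {A : κ → Matrix ι ι ℝ} (hA : ∀ a, A a ∈ rowStochastic ℝ ι)
    (hdiag : ∀ a i, 0 < A a i i) (l : List κ) (i : ι) : 0 < wordProd A l i i := by
  induction l with
  | nil => simp [wordProd]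
  | cons a l ih =>
    exact mul_apply_pos (wordProd_mem_rowStochastic hA l).1 (hA a).1 ih (hdiag a i)

/-- If every agent is reachable from `r`, some word has a product whose column `r` is positive. -/
theorem exists_wordProd_col_pos {A : κ → Matrix ι ι ℝ} (hA : ∀ a, A a ∈ rowStochastic ℝ ι)
    (hdiag : ∀ a i, 0 < A a i i) (r : ι)
    (hr : ∀ i, Relation.ReflTransGen (fun j k => ∃ a, 0 < A a k j) r i) :
    ∃ l : List κ, ∀ i, 0 < wordProd A l i r := by
  have hreach : ∀ i, ∃ l : List κ, 0 < wordProd A l i r := by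
    intro i
    induction hr i with
    | refl => exact ⟨[], by simp [wordProd]⟩
    | tail _ h ih =>
      obtain ⟨l, hl⟩ := ih
      obtain ⟨a, ha⟩ := h
      refine ⟨l ++ [a], ?_⟩
      rw [wordProd_append]
      refine mul_apply_pos (wordProd_mem_rowStochastic hA _).1
        (wordProd_mem_rowStochastic hA l).1 ?_ hl
      simpa [wordProd] using ha
  have hfin : ∀ s : Finset ι, ∃ l : List κ, ∀ i ∈ s, 0 < wordProd A l i r := by
    intro s
    induction s using Finset.induction_on with
    | empty => exact ⟨[], by simp⟩
    | insert j s _ ih =>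
      obtain ⟨l, hl⟩ := ih
      obtain ⟨l', hl'⟩ := hreach j
      refine ⟨l' ++ l, fun i hi => ?_⟩
      rw [wordProd_append]
      rcases Finset.mem_insert.1 hi with rfl | hi
      · exact mul_apply_pos (wordProd_mem_rowStochastic hA l).1
          (wordProd_mem_rowStochastic hA l').1 (wordProd_diag_pos hA hdiag l i) hl'
      · exact mul_apply_pos (wordProd_mem_rowStochastic hA l).1
          (wordProd_mem_rowStochastic hA l').1 (hl i hi) (wordProd_diag_pos hA hdiag l' r)
  obtain ⟨l, hl⟩ := hfin Finset.univ
  exact ⟨l, fun i => hl i (Finset.mem_univ i)⟩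

theorem mulVec_le_of_col_le {A : Matrix ι ι ℝ} (hA : A ∈ rowStochastic ℝ ι) {r : ι} {δ : ℝ}
    (hδ : ∀ i, δ ≤ A i r) {v : ι → ℝ} {b : ℝ} (hv : ∀ i, v i ≤ b) (i : ι) :
    (A *ᵥ v) i ≤ (1 - δ) * b + δ * v r := by
  have hsum : ∑ j, A i j = 1 := by
    have := congrFun hA.2 i
    simpa [Matrix.mulVec, dotProduct] using this
  have hgap : A i r * (b - v r) ≤ ∑ j, A i j * (b - v j) :=
    Finset.single_le_sum (f := fun j => A i j * (b - v j))
      (fun j _ => mul_nonneg (hA.1 i j) (sub_nonneg.2 (hv j))) (Finset.mem_univ r)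
  have hexp : ∑ j, A i j * (b - v j) = b - (A *ᵥ v) i := by
    simp only [mul_sub, Finset.sum_sub_distrib, ← Finset.sum_mul, hsum, one_mul]
    rfl
  have := mul_le_mul_of_nonneg_right (hδ i) (sub_nonneg.2 (hv r))
  rw [hexp] at hgap
  linarith

theorem le_mulVec_of_col_le {A : Matrix ι ι ℝ} (hA : A ∈ rowStochastic ℝ ι) {r : ι} {δ : ℝ}
    (hδ : ∀ i, δ ≤ A i r) {v : ι → ℝ} {a : ℝ} (hv : ∀ i, a ≤ v i) (i : ι) :
    (1 - δ) * a + δ * v r ≤ (A *ᵥ v) i := by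
  have := mulVec_le_of_col_le hA hδ (v := -v) (b := -a) (fun j => neg_le_neg (hv j)) i
  simp only [Matrix.mulVec_neg, Pi.neg_apply] at this
  linarith

theorem iSup_sub_iInf_mulVec_le [Nonempty ι] {A : Matrix ι ι ℝ} (hA : A ∈ rowStochastic ℝ ι)
    {r : ι} {δ : ℝ} (hδ : ∀ i, δ ≤ A i r) (v : ι → ℝ) :
    (⨆ i, (A *ᵥ v) i) - ⨅ i, (A *ᵥ v) i ≤ (1 - δ) * ((⨆ i, v i) - ⨅ i, v i) := by
  have h1 := ciSup_le (mulVec_le_of_col_le hA hδ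
    (le_ciSup (Set.finite_range v).bddAbove))
  have h2 := le_ciInf (le_mulVec_of_col_le hA hδ
    (ciInf_le (Set.finite_range v).bddBelow))
  linarith

/-- A trajectory of row-stochastic steps whose oscillation is contracted infinitely often by a
fixed factor reaches consensus. -/
theorem exists_tendsto_of_frequently_contract [Nonempty ι] {M : ℕ → Matrix ι ι ℝ}
    (hM : ∀ t, M t ∈ rowStochastic ℝ ι) {x : ℕ → ι → ℝ} (hx : ∀ t, x (t + 1) = M (t + 1) *ᵥ x t)
    {δ : ℝ} (hδ : 0 < δ) (m : ℕ)
    (hcontr : ∀ N, ∃ t ≥ N, (⨆ i, x (t + m) i) - ⨅ i, x (t + m) i ≤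
      (1 - δ) * ((⨆ i, x t i) - ⨅ i, x t i)) :
    ∃ c : ℝ, ∀ i, Tendsto (fun t => x t i) atTop (nhds c) := by
  have hle : ∀ t i, x t i ≤ ⨆ j, x t j := fun t => le_ciSup (Set.finite_range (x t)).bddAbove
  have hge : ∀ t i, ⨅ j, x t j ≤ x t i := fun t => ciInf_le (Set.finite_range (x t)).bddBelow
  have hsup : Antitone fun t => ⨆ i, x t i := antitone_nat_of_succ_le fun t => by
    refine ciSup_le fun i => ?_
    have := mulVec_le_of_col_le (hM (t + 1)) (r := i) (fun j => (hM (t + 1)).1 j i) (hle t) i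
    simpa [hx] using this
  have hinf : Monotone fun t => ⨅ i, x t i := monotone_nat_of_le_succ fun t => by
    refine le_ciInf fun i => ?_
    have := le_mulVec_of_col_le (hM (t + 1)) (r := i) (fun j => (hM (t + 1)).1 j i) (hge t) i
    simpa [hx] using this
  obtain ⟨i₀⟩ := ‹Nonempty ι›
  have hbelow : BddBelow (Set.range fun t => ⨆ i, x t i) := by
    refine ⟨⨅ i, x 0 i, ?_⟩
    rintro _ ⟨t, rfl⟩
    exact (hinf (Nat.zero_le t)).trans ((hge t i₀).trans (hle t i₀))
  have habove : BddAbove (Set.range fun t => ⨅ i, x t i) := by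
    refine ⟨⨆ i, x 0 i, ?_⟩
    rintro _ ⟨t, rfl⟩
    exact ((hge t i₀).trans (hle t i₀)).trans (hsup (Nat.zero_le t))
  have hS := tendsto_atTop_ciInf hsup hbelow
  have hI := tendsto_atTop_ciSup hinf habove
  set S := ⨅ t, ⨆ i, x t i
  set I := ⨆ t, ⨅ i, x t i
  have hIS : I ≤ S := le_of_tendsto_of_tendsto' hI hS fun t => (hge t i₀).trans (hle t i₀)
  have hosc := hS.sub hI
  have hlow : S - I ≤ (1 - δ) * (S - I) := by
    refine ge_of_tendsto_of_frequently (hosc.const_mul (1 - δ)) ?_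
    refine Filter.frequently_atTop.2 fun N => ?_
    obtain ⟨t, ht, h⟩ := hcontr N
    refine ⟨t, ht, le_trans ?_ h⟩
    exact sub_le_sub (ciInf_le hbelow (t + m)) (le_ciSup habove (t + m))
  have hSI : I = S := le_antisymm hIS (by nlinarith)
  rw [hSI] at hI
  exact ⟨S, fun i => tendsto_of_tendsto_of_tendsto_of_le_of_le hI hS
    (fun t => hge t i) (fun t => hle t i)⟩

theorem trajectory_eq_wordProd_mulVec {A : κ → Matrix ι ι ℝ} {ω : ℕ → κ} {x : ℕ → ι → ℝ}
    (hx : ∀ t, x (t + 1) = A (ω (t + 1)) *ᵥ x t) (l : List κ) (t : ℕ)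
    (hl : ∀ s (h : s < l.length), ω (t + 1 + s) = l[s]) :
    x (t + l.length) = wordProd A l *ᵥ x t := by
  induction l generalizing t with
  | nil => simp [wordProd]
  | cons a l ih =>
    have h0 : ω (t + 1) = a := hl 0 (by simp)
    have := ih (t + 1) fun s h => by
      have := hl (s + 1) (by simpa using h)
      rw [List.getElem_cons_succ] at this
      rw [← this]
      congr 1
      ring
    rw [wordProd, ← Matrix.mulVec_mulVec, ← h0, ← hx, ← this, List.length_cons]
    congr 1
    ring

/-- If every word occurs along `ω`, the backward products converge to a matrix with equal rows. -/
theorem exists_tendsto_backProd [Nonempty κ] {A : κ → Matrix ι ι ℝ}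
    (hA : ∀ a, A a ∈ rowStochastic ℝ ι) (hdiag : ∀ a i, 0 < A a i i) (r : ι)
    (hr : ∀ i, Relation.ReflTransGen (fun j k => ∃ a, 0 < A a k j) r i)
    {ω : ℕ → κ} (hω : ∀ (m : ℕ) (w : Fin m → κ), ∃ t, ∀ s : Fin m, ω (t + s) = w s) :
    ∃ c : ι → ℝ, ∀ i j,
      Tendsto (fun t => backProd (fun t => A (ω t)) t i j) atTop (nhds (c j)) := by
  have : Nonempty ι := ⟨r⟩
  obtain ⟨l, hl⟩ := exists_wordProd_col_pos hA hdiag r hr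
  obtain ⟨i₀, hi₀⟩ := Finite.exists_min fun i => wordProd A l i r
  suffices h : ∀ j, ∃ c : ℝ, ∀ i,
      Tendsto (fun t => backProd (fun t => A (ω t)) t i j) atTop (nhds c) by
    choose c hc using h
    exact ⟨c, fun i j => hc j i⟩
  intro j
  have hx : ∀ t, (fun i => backProd (fun t => A (ω t)) (t + 1) i j) =
      A (ω (t + 1)) *ᵥ fun i => backProd (fun t => A (ω t)) t i j := fun t => rfl
  refine exists_tendsto_of_frequently_contract (M := fun t => A (ω t)) (fun t => hA _)
    (x := fun t i => backProd (fun t => A (ω t)) t i j) hx (hl i₀) l.length fun N => ?_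
  obtain ⟨a⟩ := ‹Nonempty κ›
  obtain ⟨t, ht⟩ := hω (N + 1 + l.length) fun s =>
    if h : N + 1 ≤ s then l[s - (N + 1)]'(by have := s.2; omega) else a
  refine ⟨t + N, Nat.le_add_left N t, ?_⟩
  have := trajectory_eq_wordProd_mulVec
    (x := fun t i => backProd (fun t => A (ω t)) t i j) hx l (t + N) fun s h => by
      have := ht ⟨N + 1 + s, by omega⟩
      simp only [le_add_iff_nonneg_right, zero_le, dite_true, Nat.add_sub_cancel_left] at this
      rw [← this]
      congr 1
      ring
  have hc := iSup_sub_iInf_mulVec_le (wordProd_mem_rowStochastic hA l) hi₀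
    (fun i => backProd (fun t => A (ω t)) (t + N) i j)
  rw [← this] at hc
  exact hc

end Contraction

section Words

/-- The event that a cylinder of length `M` occurs and the word `w` is avoided in the next `K`
blocks. -/
theorem measure_avoid_le {n : ℕ} {μ : Measure (ℕ → Fin n)} (hμ : isIIDUniform μ) {m : ℕ}
    (w : Fin m → Fin n) (K M : ℕ) (f : ℕ → Fin n) :
    μ {ω | (∀ t < M, ω t = f t) ∧ ∀ k < K, ¬ ∀ s : Fin m, ω (M + k * m + s) = w s} ≤
      ((n ^ m - 1 : ℕ) : ENNReal) ^ K * (1 / (n : ENNReal)) ^ (M + K * m) := by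
  induction K generalizing M f with
  | zero => simpa using (hμ.2 M f).le
  | succ K ih =>
    let F (g : Fin m → Fin n) (t : ℕ) : Fin n :=
      if h : M ≤ t ∧ t - M < m then g ⟨t - M, h.2⟩ else f t
    have hsub : {ω : ℕ → Fin n | (∀ t < M, ω t = f t) ∧
          ∀ k < K + 1, ¬ ∀ s : Fin m, ω (M + k * m + s) = w s} ⊆
        ⋃ g ∈ (Finset.univ.erase w : Finset (Fin m → Fin n)),
          {ω | (∀ t < M + m, ω t = F g t) ∧
            ∀ k < K, ¬ ∀ s : Fin m, ω (M + m + k * m + s) = w s} := by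
      rintro ω ⟨h1, h2⟩
      simp only [Set.mem_iUnion, Set.mem_ofPred_eq]
      refine ⟨fun s => ω (M + s), ?_, ?_, ?_⟩
      · refine Finset.mem_erase.2 ⟨fun h => h2 0 (by omega) fun s => ?_, Finset.mem_univ _⟩
        simpa using congrFun h s
      · intro t ht
        by_cases h : M ≤ t
        · have h' : M ≤ t ∧ t - M < m := by omega
          simp only [F, dif_pos h']
          congr 1
          omega
        · simp only [F, h, false_and, dite_false]
          exact h1 t (by omega)
      · intro k hk h
        refine h2 (k + 1) (by omega) fun s => ?_
        rw [← h s]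
        congr 1
        ring
    refine (measure_mono hsub).trans ((measure_biUnion_finset_le _ _).trans ?_)
    refine (Finset.sum_le_sum fun g _ => ih (M + m) (F g)).trans ?_
    rw [Finset.sum_const, Finset.card_erase_of_mem (Finset.mem_univ w), nsmul_eq_mul]
    simp only [Finset.card_univ, Fintype.card_fun, Fintype.card_fin]
    rw [pow_succ' _ K, mul_assoc, show M + (K + 1) * m = M + m + K * m by ring]

theorem ae_forall_word_occurs {n : ℕ} (hn : 0 < n) {μ : Measure (ℕ → Fin n)}
    (hμ : isIIDUniform μ) :
    ∀ᵐ ω ∂μ, ∀ (m : ℕ) (w : Fin m → Fin n), ∃ t, ∀ s : Fin m, ω (t + s) = w s := by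
  refine ae_all_iff.2 fun m => ae_all_iff.2 fun w => ?_
  have hpos : 0 < n ^ m := pow_pos hn m
  set q : ENNReal := ((n ^ m - 1 : ℕ) : ENNReal) * (1 / (n : ENNReal)) ^ m with hq
  have hq1 : q < 1 := by
    rw [hq, one_div, ← ENNReal.inv_pow, ← div_eq_mul_inv]
    refine ENNReal.div_lt_of_lt_mul' ?_
    rw [mul_one]
    exact_mod_cast Nat.sub_lt hpos one_pos
  refine le_antisymm (ge_of_tendsto' (ENNReal.tendsto_pow_atTop_nhds_zero_of_lt_one hq1)
    fun K => ?_) zero_le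
  have h := measure_avoid_le hμ w K 0 (fun _ => ⟨0, hn⟩)
  rw [zero_add, mul_comm K m, pow_mul, ← mul_pow] at h
  refine (measure_mono ?_).trans h
  intro ω hω
  refine ⟨fun t ht => absurd ht (Nat.not_lt_zero t), fun k _ hk => hω ⟨0 + k * m, hk⟩⟩

end Words

section Blocks

variable {n d : ℕ} {W : Fin n → Fin n → Matrix (Fin d) (Fin d) ℝ} {τ : ℝ}

/-- The update matrix of the `i`-th coordinate when agent `v` is active. -/
noncomputable def blockStep (W : Fin n → Fin n → Matrix (Fin d) (Fin d) ℝ) (τ : ℝ) (i : Fin d) (v : Fin n) :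
    Matrix (Fin n) (Fin n) ℝ :=
  fun k m => if k = v then Pmat W τ i k m else if k = m then 1 else 0

theorem backProd_Pt_apply (ω : ℕ → Fin n) (t : ℕ) (p q : Fin d × Fin n) :
    backProd (Pt W τ ω) t p q =
      if p.1 = q.1 then backProd (fun t => blockStep W τ p.1 (ω t)) t p.2 q.2 else 0 := by
  have hPt : ∀ t p q, Pt W τ ω t p q =
      if p.1 = q.1 then blockStep W τ p.1 (ω t) p.2 q.2 else 0 := by
    rintro t ⟨i, k⟩ ⟨j, m⟩
    by_cases h : i = j <;> simp [Pt, bigP, blockStep, h]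
  induction t generalizing p q with
  | zero => exact hPt 0 p q
  | succ t ih =>
    obtain ⟨i, k⟩ := p
    obtain ⟨j, m⟩ := q
    simp only [backProd, Matrix.mul_apply, Fintype.sum_prod_type, hPt, ih]
    by_cases h : i = j
    · subst h
      simp [Finset.sum_ite_irrel]
    · simp [Finset.sum_ite_irrel, h]

theorem diag_nonneg (hPD : ∀ i j, W i j ≠ 0 → (W i j).PosDef) (k l : Fin n) (i : Fin d) :
    0 ≤ W k l i i := by
  by_cases h : W k l = 0
  · simp [h]
  · exact (hPD k l h).diag_pos.le

theorem sum_nbhd_msgn (hPD : ∀ i j, W i j ≠ 0 → (W i j).PosDef) (k : Fin n) (i : Fin d) :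
    ∑ l ∈ nbhd W k, msgn (W k l) * W k l i i = ∑ l, W k l i i := by
  rw [nbhd, Finset.sum_filter]
  refine Finset.sum_congr rfl fun l _ => ?_
  by_cases h : W k l = 0
  · simp [h]
  · simp [h, msgn, hPD k l h]

theorem Pmat_diag_pos (hτ : stepOK W τ) (i : Fin d) (k : Fin n) : 0 < Pmat W τ i k k := by
  have := hτ.2 k i i
  simp only [Pmat, if_true]
  linarith

theorem blockStep_diag_pos (hτ : stepOK W τ) (i : Fin d) (v k : Fin n) :
    0 < blockStep W τ i v k k := by
  by_cases h : k = v
  · simpa [blockStep, h] using Pmat_diag_pos hτ i v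
  · simp [blockStep, h]

theorem sum_Pmat (hdiag : ∀ i, W i i = 0) (hPD : ∀ i j, W i j ≠ 0 → (W i j).PosDef)
    (i : Fin d) (k : Fin n) : ∑ m, Pmat W τ i k m = 1 := by
  have h : ∀ m, Pmat W τ i k m =
      (if k = m then 1 - τ * ∑ l, W k l i i else 0) + τ * W k m i i := by
    intro m
    unfold Pmat
    rw [sum_nbhd_msgn hPD]
    split_ifs with h
    · subst h
      simp [hdiag]
    · simp
  simp [h, Finset.sum_add_distrib, ← Finset.mul_sum]

theorem blockStep_mem_rowStochastic (hdiag : ∀ i, W i i = 0)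
    (hPD : ∀ i j, W i j ≠ 0 → (W i j).PosDef) (hτ : stepOK W τ) (i : Fin d) (v : Fin n) :
    blockStep W τ i v ∈ rowStochastic ℝ (Fin n) := by
  refine mem_rowStochastic_iff_sum.2 ⟨fun k m => ?_, fun k => ?_⟩
  · by_cases hkm : k = m
    · subst hkm
      exact (blockStep_diag_pos hτ i v k).le
    · simp only [blockStep, Pmat, hkm, if_false]
      split_ifs
      exacts [mul_nonneg hτ.1.le (diag_nonneg hPD k m i), le_rfl]
  · unfold blockStep
    split_ifs
    · exact sum_Pmat hdiag hPD i k
    · simp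

end Blocks

/-- for μ-a.e. ω, the products 𝓟(t)⋯𝓟(0) converge entrywise to a
block-diagonal matrix whose diagonal blocks have all rows equal. -/
theorem stmt2 {n d : ℕ} (hn : 0 < n) (hd : 0 < d)
    (W : Fin n → Fin n → Matrix (Fin d) (Fin d) ℝ)
    (hsym : ∀ i j, (W i j).IsSymm) (hdiag : ∀ i, W i i = 0)
    (hPD : ∀ i j, W i j ≠ 0 → (W i j).PosDef)
    (htree : hasSpanningTree W)
    (τ : ℝ) (hτ : stepOK W τ)
    (μ : Measure (ℕ → Fin n)) (hμ : isIIDUniform μ) :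
    ∀ᵐ ω ∂μ, ∃ L : Matrix (Fin d × Fin n) (Fin d × Fin n) ℝ,
      Tendsto (fun t => backProd (Pt W τ ω) t) atTop (nhds L) ∧
      (∀ p q : Fin d × Fin n, p.1 ≠ q.1 → L p q = 0) ∧
      (∀ (i : Fin d) (k k' m : Fin n), L (i, k) (i, m) = L (i, k') (i, m)) := by
  have : Nonempty (Fin n) := ⟨⟨0, hn⟩⟩
  obtain ⟨r, hr⟩ := htree
  filter_upwards [ae_forall_word_occurs hn hμ] with ω hω
  have hblock : ∀ i : Fin d, ∃ c : Fin n → ℝ, ∀ k m, Tendsto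
      (fun t => backProd (fun t => blockStep W τ i (ω t)) t k m) atTop (nhds (c m)) := by
    intro i
    refine exists_tendsto_backProd (blockStep_mem_rowStochastic hdiag hPD hτ i)
      (blockStep_diag_pos hτ i) r (fun k => ?_) hω
    refine Relation.ReflTransGen.mono (fun a b hab => ⟨b, ?_⟩) _ _ (hr k)
    have hne : b ≠ a := by
      rintro rfl
      exact hab (hdiag b)
    simpa [blockStep, Pmat, hne] using mul_pos hτ.1 (hPD b a hab).diag_pos
  choose c hc using hblock
  refine ⟨fun p q => if p.1 = q.1 then c p.1 q.2 else 0, ?_, ?_, ?_⟩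
  · refine tendsto_pi_nhds.2 fun p => tendsto_pi_nhds.2 fun q => ?_
    simp only [backProd_Pt_apply]
    split_ifs
    exacts [hc p.1 p.2 q.2, tendsto_const_nhds]
  · intro p q h
    simp [h]
  · intro i k k' m
    simp
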